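/- arXiv:2409.16679 — 6 statements merged into one kernel-verified Lean document; each statement's English description precedes it below -/
import Mathlib

section
/- Let (G, ·, ⋆) be a multiplicative Lie algebra whose underlying group is nilpotent of class 2. Then the only multiplicative Lie algebra structure induced on the commutator subgroup [G,G] is trivial: g ⋆ g' = 1 for all g, g' ∈ [G,G]. -/
/-- A multiplicative Lie algebra structure on a group `G`: a binary operation `s`
satisfying the five axioms of Ellis (with `^z x = z*x*z⁻¹`). -/
def IsMulLie {G : Type*} [Group G] (s : G → G → G) : Prop :=
  (∀ x : G, s x x = 1) ∧
  (∀ x y z : G, s x (y * z) = s x y * (y * s x z * y⁻¹)) ∧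
  (∀ x y z : G, s (x * y) z = (x * s y z * x⁻¹) * s x z) ∧
  (∀ x y z : G,
    s (s x y) (y * z * y⁻¹) * s (s y z) (z * x * z⁻¹) * s (s z x) (x * y * x⁻¹) = 1) ∧
  (∀ x y z : G, z * s x y * z⁻¹ = s (z * x * z⁻¹) (z * y * z⁻¹))

/-- For fixed `z`, the map `x ↦ x ⋆ z` becomes a homomorphism after abelianizing, so it sends
the commutator subgroup into itself. -/
theorem IsMulLie.mem_commutator_of_left {G : Type*} [Group G] {s : G → G → G} (hs : IsMulLie s)
    {g : G} (hg : g ∈ commutator G) (z : G) : s g z ∈ commutator G := by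
  let φ : G →* Abelianization G := MonoidHom.mk' (fun x => Abelianization.of (s x z)) fun x y => by
    simp only [hs.2.2.1 x y z, map_mul, map_inv, mul_inv_cancel_comm]
    exact mul_comm _ _
  have h : Abelianization.of (s g z) = 1 := Abelianization.commutator_subset_ker φ hg
  rwa [← MonoidHom.mem_ker, Abelianization.ker_of] at h

/-- If every `g ⋆ y` is central, then `y ↦ g ⋆ y` is a homomorphism into an abelian group, so it
is trivial on the commutator subgroup. -/
theorem IsMulLie.eq_one_of_forall_mem_center {G : Type*} [Group G] {s : G → G → G}
    (hs : IsMulLie s) {g g' : G} (hg : ∀ y, s g y ∈ Subgroup.center G)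
    (hg' : g' ∈ commutator G) : s g g' = 1 := by
  let ψ : G →* Subgroup.center G := MonoidHom.mk' (fun y => ⟨s g y, hg y⟩) fun y z => by
    ext
    simp [hs.2.1 g y z, Subgroup.mem_center_iff.mp (hg z) y]
  open scoped IsMulCommutative in
  have h : ψ g' = 1 := Abelianization.commutator_subset_ker (A := Subgroup.center G) ψ hg'
  exact congrArg Subtype.val h

/-- If the underlying group of a multiplicative Lie algebra is nilpotent of class 2
(`[G,G] ⊆ Z(G)`), then the induced structure on the commutator subgroup is trivial:
`g ⋆ g' = 1` for all `g, g' ∈ [G,G]`. -/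
theorem stmt_5 {G : Type*} [Group G] (s : G → G → G) (hs : IsMulLie s)
    (hnil : commutator G ≤ Subgroup.center G) :
    ∀ g g' : G, g ∈ commutator G → g' ∈ commutator G → s g g' = 1 :=
  fun _ _ hg hg' =>
    hs.eq_one_of_forall_mem_center (fun y => hnil (hs.mem_commutator_of_left hg y)) hg'
end

section
/- Let (G, ·, ⋆) be a multiplicative Lie algebra whose underlying group is nilpotent of class 2. Then the subgroup G ⋆ G of G generated by the set {x ⋆ y : x, y ∈ G} is abelian; in particular (x ⋆ y)·(u ⋆ v) = (u ⋆ v)·(x ⋆ y) for all x, y, u, v ∈ G. -/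
/-- In a multiplicative Lie algebra, conjugating `z ⋆ w` by `x * y` or by `y * x` differs exactly
by conjugation by `x ⋆ y`; this comes from expanding `(x * z) ⋆ (y * w)` in two ways. -/
theorem IsMulLie.conj_mul_comm {G : Type*} [Group G] {s : G → G → G} (hs : IsMulLie s)
    (x y z w : G) :
    (x * y * s z w * (x * y)⁻¹) * s x y = s x y * (y * x * s z w * (y * x)⁻¹) := by
  obtain ⟨-, h2, h3, -, -⟩ := hs
  have h : s (x * z) (y * w) = s (x * z) (y * w) := rfl
  conv_lhs at h => rw [h3, h2 z, h2 x]
  conv_rhs at h => rw [h2, h3 x z y, h3 x z w]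
  have hexp : (x * s z y * x⁻¹) * ((x * y * s z w * (x * y)⁻¹) * s x y) * (y * s x w * y⁻¹) =
      (x * s z y * x⁻¹) * (s x y * (y * x * s z w * (y * x)⁻¹)) * (y * s x w * y⁻¹) := by
    simpa [mul_assoc] using h
  exact mul_left_cancel (mul_right_cancel hexp)

open scoped commutatorElement in
/-- If `G` is nilpotent of class 2, conjugation by `x * y` agrees with conjugation by `y * x`. -/
theorem conj_mul_swap_of_commutator_le_center {G : Type*} [Group G]
    (hnil : commutator G ≤ Subgroup.center G) (x y g : G) :
    y * x * g * (y * x)⁻¹ = x * y * g * (x * y)⁻¹ := by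
  have hc : ⁅y, x⁆ ∈ Subgroup.center G :=
    hnil (Subgroup.commutator_mem_commutator (Subgroup.mem_top y) (Subgroup.mem_top x))
  have hyx : y * x = ⁅y, x⁆ * (x * y) := by simp [commutatorElement_def, mul_assoc]
  have hcomm := Subgroup.mem_center_iff.mp hc (x * y * g * (x * y)⁻¹)
  calc y * x * g * (y * x)⁻¹ = ⁅y, x⁆ * (x * y * g * (x * y)⁻¹) * ⁅y, x⁆⁻¹ := by
        rw [hyx]; group
    _ = x * y * g * (x * y)⁻¹ := by rw [← hcomm, mul_inv_cancel_right]

/-- In a multiplicative Lie algebra of nilpotency class 2, any two brackets commute. -/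
theorem IsMulLie.bracket_mul_comm {G : Type*} [Group G] {s : G → G → G} (hs : IsMulLie s)
    (hnil : commutator G ≤ Subgroup.center G) (x y u v : G) :
    s x y * s u v = s u v * s x y := by
  have h := hs.conj_mul_comm x y ((x * y)⁻¹ * u * (x * y)) ((x * y)⁻¹ * v * (x * y))
  have h5 := hs.2.2.2.2 ((x * y)⁻¹ * u * (x * y)) ((x * y)⁻¹ * v * (x * y)) (x * y)
  rw [conj_mul_swap_of_commutator_le_center hnil x y, h5] at h
  have key : ∀ c g : G, c * (c⁻¹ * g * c) * c⁻¹ = g := fun c g => by group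
  rw [key, key] at h
  exact h.symm

/-- If the underlying group of a multiplicative Lie algebra is nilpotent of class 2,
then the subgroup `G ⋆ G` generated by `{x ⋆ y : x, y ∈ G}` is abelian; in
particular any two elements of the form `x ⋆ y` commute. -/
theorem stmt_6 {G : Type*} [Group G] (s : G → G → G) (hs : IsMulLie s)
    (hnil : commutator G ≤ Subgroup.center G) :
    (∀ a b : G, a ∈ Subgroup.closure {g : G | ∃ x y : G, s x y = g} →
      b ∈ Subgroup.closure {g : G | ∃ x y : G, s x y = g} → a * b = b * a) ∧
    (∀ x y u v : G, s x y * s u v = s u v * s x y) := by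
  have hcomm := hs.bracket_mul_comm hnil
  refine ⟨fun a b ha hb => ?_, hcomm⟩
  refine Subgroup.closure_induction₂ (p := fun a b _ _ => Commute a b) ?_
    (fun a _ => Commute.one_left a) (fun a _ => Commute.one_right a)
    (fun _ _ _ _ _ _ h₁ h₂ => h₁.mul_left h₂) (fun _ _ _ _ _ _ h₁ h₂ => h₁.mul_right h₂)
    (fun _ _ _ _ h => h.inv_left) (fun _ _ _ _ h => h.inv_right) ha hb
  rintro _ _ ⟨x, y, rfl⟩ ⟨u, v, rfl⟩
  exact hcomm x y u v
end

section
/- Let (G, ·, ⋆) be a multiplicative Lie algebra whose underlying group is nilpotent of class 2, and suppose a ⋆ b ∈ [G,G] for all a, b ∈ G (equivalently, the induced multiplicative Lie algebra structure on G/[G,G] is trivial). Then [G,G] ⊆ LZ(G); that is, c ⋆ g = 1 for every c ∈ [G,G] and every g ∈ G. -/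
/-- If the underlying group of a multiplicative Lie algebra is nilpotent of class 2
and `a ⋆ b ∈ [G,G]` for all `a, b` (i.e. the induced structure on `G/[G,G]` is
trivial), then `[G,G] ⊆ LZ(G)`: every element of the commutator subgroup
`⋆`-annihilates every element of `G`. -/
theorem stmt_10 {G : Type*} [Group G] (s : G → G → G) (hs : IsMulLie s)
    (hnil : commutator G ≤ Subgroup.center G)
    (htriv : ∀ a b : G, s a b ∈ commutator G) :
    ∀ c g : G, c ∈ commutator G → s c g = 1 := by
  intro c g hc
  obtain ⟨-, -, hmul, -, -⟩ := hs
  have hcen (a b : G) : s a b ∈ Subgroup.center G := hnil (htriv a b)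
  let f : G →* Subgroup.center G := MonoidHom.mk' (fun x => ⟨s x g, hcen x g⟩) fun x y => by
    ext
    change s (x * y) g = s x g * s y g
    rw [hmul, Subgroup.mem_center_iff.mp (hcen y g) x, mul_inv_cancel_right,
      Subgroup.mem_center_iff.mp (hcen x g)]
  let _ : CommGroup (Subgroup.center G) :=
    { (inferInstance : Group (Subgroup.center G)) with
      mul_comm := fun a b => Subtype.ext (Subgroup.mem_center_iff.mp b.2 a) }
  exact congrArg Subtype.val
    (MonoidHom.mem_ker.mp (Abelianization.commutator_subset_ker f hc))
end

section
/- Let G be a group equipped with two multiplicative Lie algebra structures ⋆₁ and ⋆₂ such that for all x, y, z, w ∈ G: (1) the subgroups G ⋆₁ G and G ⋆₂ G (generated respectively by {a ⋆₁ b : a,b ∈ G} and {a ⋆₂ b : a,b ∈ G}) are abelian; (2) (x ⋆₁ y)·(z ⋆₂ w) = (z ⋆₂ w)·(x ⋆₁ y); and (3) ((x⋆₁y) ⋆₂ ^y z)·((x⋆₂y) ⋆₁ ^y z)·((y⋆₁z) ⋆₂ ^z x)·((y⋆₂z) ⋆₁ ^z x)·((z⋆₁x) ⋆₂ ^x y)·((z⋆₂x)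 ⋆₁ ^x y) = 1. Then the binary operation ⋆ on G defined by x ⋆ y = (x ⋆₁ y)·(x ⋆₂ y) is a multiplicative Lie algebra structure on G. -/
open scoped IsMulCommutative in
/-- A rearrangement of twelve pairwise commuting elements of a group. -/
theorem prod_eq_one_of_commute {G : Type*} [Group G] {S : Set G}
    (hS : ∀ a ∈ S, ∀ b ∈ S, a * b = b * a)
    {a₁ a₂ a₃ b₁ b₂ b₃ c₁ c₂ c₃ d₁ d₂ d₃ : G}
    (ha₁ : a₁ ∈ S) (ha₂ : a₂ ∈ S) (ha₃ : a₃ ∈ S) (hb₁ : b₁ ∈ S) (hb₂ : b₂ ∈ S) (hb₃ : b₃ ∈ S)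
    (hc₁ : c₁ ∈ S) (hc₂ : c₂ ∈ S) (hc₃ : c₃ ∈ S) (hd₁ : d₁ ∈ S) (hd₂ : d₂ ∈ S) (hd₃ : d₃ ∈ S)
    (ha : a₁ * a₂ * a₃ = 1) (hb : b₁ * b₂ * b₃ = 1) (hcd : c₁ * d₁ * c₂ * d₂ * c₃ * d₃ = 1) :
    (d₁ * a₁) * (b₁ * c₁) * ((d₂ * a₂) * (b₂ * c₂)) * ((d₃ * a₃) * (b₃ * c₃)) = 1 := by
  have : IsMulCommutative (Subgroup.closure S) := Subgroup.isMulCommutative_closure hS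
  have rearrange {M : Type _} [CommMonoid M] (a₁ a₂ a₃ b₁ b₂ b₃ c₁ c₂ c₃ d₁ d₂ d₃ : M) :
      (d₁ * a₁) * (b₁ * c₁) * ((d₂ * a₂) * (b₂ * c₂)) * ((d₃ * a₃) * (b₃ * c₃)) =
        (a₁ * a₂ * a₃) * (b₁ * b₂ * b₃) * (c₁ * d₁ * c₂ * d₂ * c₃ * d₃) := by
    ac_rfl
  let lift {x : G} (hx : x ∈ S) : Subgroup.closure S := ⟨x, Subgroup.subset_closure hx⟩
  have h := congrArg Subtype.val (rearrange (lift ha₁) (lift ha₂) (lift ha₃) (lift hb₁) (lift hb₂)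
    (lift hb₃) (lift hc₁) (lift hc₂) (lift hc₃) (lift hd₁) (lift hd₂) (lift hd₃))
  refine h.trans ?_
  change a₁ * a₂ * a₃ * (b₁ * b₂ * b₃) * (c₁ * d₁ * c₂ * d₂ * c₃ * d₃) = 1
  rw [ha, hb, hcd, one_mul, one_mul]

/-- If `⋆₁, ⋆₂` are two multiplicative Lie algebra structures on `G` such that
`G ⋆₁ G` and `G ⋆₂ G` are abelian, elements of `G ⋆₁ G` commute with elements of
`G ⋆₂ G`, and the mixed Jacobi identity holds, then `x ⋆ y := (x ⋆₁ y)(x ⋆₂ y)`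
is a multiplicative Lie algebra structure on `G`. -/
theorem stmt_14 {G : Type*} [Group G] (s1 s2 : G → G → G)
    (hs1 : IsMulLie s1) (hs2 : IsMulLie s2)
    (hab1 : ∀ a b : G, a ∈ Subgroup.closure {g : G | ∃ x y : G, s1 x y = g} →
      b ∈ Subgroup.closure {g : G | ∃ x y : G, s1 x y = g} → a * b = b * a)
    (hab2 : ∀ a b : G, a ∈ Subgroup.closure {g : G | ∃ x y : G, s2 x y = g} →
      b ∈ Subgroup.closure {g : G | ∃ x y : G, s2 x y = g} → a * b = b * a)
    (hcomm : ∀ x y z w : G, s1 x y * s2 z w = s2 z w * s1 x y)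
    (hjac : ∀ x y z : G,
      s2 (s1 x y) (y * z * y⁻¹) * s1 (s2 x y) (y * z * y⁻¹) *
      s2 (s1 y z) (z * x * z⁻¹) * s1 (s2 y z) (z * x * z⁻¹) *
      s2 (s1 z x) (x * y * x⁻¹) * s1 (s2 z x) (x * y * x⁻¹) = 1) :
    IsMulLie (fun x y => s1 x y * s2 x y) := by
  obtain ⟨self₁, mul_right₁, mul_left₁, jac₁, conj₁⟩ := hs1
  obtain ⟨self₂, mul_right₂, mul_left₂, jac₂, conj₂⟩ := hs2
  have comm₁ (x y z w : G) : s1 x y * s1 z w = s1 z w * s1 x y :=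
    hab1 _ _ (Subgroup.subset_closure ⟨x, y, rfl⟩) (Subgroup.subset_closure ⟨z, w, rfl⟩)
  have comm₂ (x y z w : G) : s2 x y * s2 z w = s2 z w * s2 x y :=
    hab2 _ _ (Subgroup.subset_closure ⟨x, y, rfl⟩) (Subgroup.subset_closure ⟨z, w, rfl⟩)
  refine ⟨fun x => ?_, fun x y z => ?_, fun x y z => ?_, fun x y z => ?_, fun x y z => ?_⟩
  · simp [self₁, self₂]
  · calc s1 x (y * z) * s2 x (y * z)
        = s1 x y * ((y * s1 x z * y⁻¹) * s2 x y) * (y * s2 x z * y⁻¹) := by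
          rw [mul_right₁, mul_right₂]; group
      _ = s1 x y * (s2 x y * (y * s1 x z * y⁻¹)) * (y * s2 x z * y⁻¹) := by
          rw [conj₁, hcomm]
      _ = s1 x y * s2 x y * (y * (s1 x z * s2 x z) * y⁻¹) := by group
  · calc s1 (x * y) z * s2 (x * y) z
        = (x * s1 y z * x⁻¹) * (s1 x z * (x * s2 y z * x⁻¹)) * s2 x z := by
          rw [mul_left₁, mul_left₂]; group
      _ = (x * s1 y z * x⁻¹) * ((x * s2 y z * x⁻¹) * s1 x z) * s2 x z := by
          rw [conj₂, hcomm]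
      _ = x * (s1 y z * s2 y z) * x⁻¹ * (s1 x z * s2 x z) := by group
  · have expand (x y c : G) : s1 (s1 x y * s2 x y) c * s2 (s1 x y * s2 x y) c =
        (s1 (s2 x y) c * s1 (s1 x y) c) * (s2 (s2 x y) c * s2 (s1 x y) c) := by
      rw [mul_left₁, mul_left₂, comm₁ x y, hcomm x y, mul_inv_cancel_right, mul_inv_cancel_right]
    have hS : ∀ a ∈ {g : G | ∃ x y, s1 x y = g ∨ s2 x y = g},
        ∀ b ∈ {g : G | ∃ x y, s1 x y = g ∨ s2 x y = g}, a * b = b * a := by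
      rintro _ ⟨x, y, rfl | rfl⟩ _ ⟨z, w, rfl | rfl⟩
      exacts [comm₁ .., hcomm .., (hcomm ..).symm, comm₂ ..]
    have mem₁ (x y : G) : s1 x y ∈ {g : G | ∃ x y, s1 x y = g ∨ s2 x y = g} :=
      ⟨x, y, .inl rfl⟩
    have mem₂ (x y : G) : s2 x y ∈ {g : G | ∃ x y, s1 x y = g ∨ s2 x y = g} :=
      ⟨x, y, .inr rfl⟩
    simp only [expand]
    exact prod_eq_one_of_commute hS (mem₁ ..) (mem₁ ..) (mem₁ ..) (mem₂ ..) (mem₂ ..) (mem₂ ..)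
      (mem₂ ..) (mem₂ ..) (mem₂ ..) (mem₁ ..) (mem₁ ..) (mem₁ ..) (jac₁ x y z) (jac₂ x y z)
      (hjac x y z)
  · simp only [← conj₁, ← conj₂]
    group
end

section
/- Let G be a group that is nilpotent of class 2, let ⋆₁ be a multiplicative Lie algebra structure on G with [G,G] ⊆ LZ(G) with respect to ⋆₁ (i.e. c ⋆₁ g = 1 for every c ∈ [G,G] and g ∈ G), and let ⋆₂ be any other multiplicative Lie algebra structure on G. If ((x⋆₁y) ⋆₂ ^y z)·((x⋆₂y) ⋆₁ ^y z)·((y⋆₁z) ⋆₂ ^z x)·((y⋆₂z) ⋆₁ ^z x)·((z⋆₁x) ⋆₂ ^x y)·((z⋆₂x) ⋆₁ ^x y) = 1 for all x, y, z ∈ G, then the binary operation ⋆ defined by x ⋆ y = (x ⋆₁ y)·(x ⋆₂ y) is a multiplicative Lie algebra structure on G. -/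
namespace IsMulLie

variable {G : Type*} [Group G] {s : G → G → G}

theorem swap_eq_inv (h : IsMulLie s) (x y : G) : s y x = (s x y)⁻¹ := by
  obtain ⟨h1, h2, h3, -, -⟩ := h
  have e := h1 (y * x)
  rw [h2, h3, h3, h1, h1] at e
  have e' : y * (s x y * s y x) * y⁻¹ = 1 := by rw [← e]; group
  exact eq_inv_of_mul_eq_one_right (conj_eq_one_iff.mp e')

theorem mul_conj_comm (h : IsMulLie s) (x y a b : G) :
    s x y * (y * x * s a b * (y * x)⁻¹) = x * y * s a b * (x * y)⁻¹ * s x y := by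
  obtain ⟨-, h2, h3, -, -⟩ := h
  have e : s (x * a) (y * b) = s (x * a) (y * b) := rfl
  conv_lhs at e => rw [h2, h3, h3]
  conv_rhs at e => rw [h3, h2, h2]
  have e' : x * s a y * x⁻¹ * (s x y * (y * x * s a b * (y * x)⁻¹)) * (y * s x b * y⁻¹) =
      x * s a y * x⁻¹ * (x * y * s a b * (x * y)⁻¹ * s x y) * (y * s x b * y⁻¹) := by
    convert e using 1 <;> group
  exact mul_left_cancel (mul_right_cancel e')

theorem commute_of_mem_center (h : IsMulLie s) {z : G} (hz : z ∈ Subgroup.center G)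
    (w a b : G) : Commute (s z w) (s a b) := by
  have e := h.mul_conj_comm z w (w⁻¹ * a * w) (w⁻¹ * b * w)
  have hw : w * z = z * w := Subgroup.mem_center_iff.mp hz w
  have hc : z * w * s (w⁻¹ * a * w) (w⁻¹ * b * w) * (z * w)⁻¹ = z * s a b * z⁻¹ := by
    have := h.2.2.2.2 (w⁻¹ * a * w) (w⁻¹ * b * w) w
    simp only [mul_assoc, mul_inv_cancel_left, mul_inv_cancel, mul_one] at this
    rw [← this]
    group
  have hs : z * s a b * z⁻¹ = s a b := by
    rw [← Subgroup.mem_center_iff.mp hz, mul_inv_cancel_right]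
  rwa [hw, hc, hs] at e

theorem mem_center_of_left (h : IsMulLie s) {z : G} (hz : z ∈ Subgroup.center G) (w : G) :
    s z w ∈ Subgroup.center G := by
  refine Subgroup.mem_center_iff.mpr fun a => ?_
  have hza := Subgroup.mem_center_iff.mp hz
  have e : a * s z w * a⁻¹ * s a w = z * s a w * z⁻¹ * s z w := by
    rw [← h.2.2.1, ← h.2.2.1, hza]
  rw [← hza, mul_inv_cancel_right, ← (h.commute_of_mem_center hz w a w).eq] at e
  exact mul_inv_eq_iff_eq_mul.mp (mul_right_cancel e)

open scoped commutatorElement in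
theorem conj_left (h : IsMulLie s) (hLZ : ∀ c g : G, c ∈ commutator G → s c g = 1)
    (g x y : G) : s (g * x * g⁻¹) y = s x y := by
  have hc : ⁅x⁻¹, g⁆ ∈ commutator G :=
    Subgroup.commutator_mem_commutator (Subgroup.mem_top _) (Subgroup.mem_top _)
  have hx : g * x * g⁻¹ = x * ⁅x⁻¹, g⁆ := by simp [commutatorElement_def, mul_assoc]
  rw [hx, h.2.2.1, hLZ _ _ hc]
  simp

theorem mem_center (h : IsMulLie s) (hLZ : ∀ c g : G, c ∈ commutator G → s c g = 1)
    (x y : G) : s x y ∈ Subgroup.center G := by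
  refine Subgroup.mem_center_iff.mpr fun g => mul_inv_eq_iff_eq_mul.mp ?_
  rw [h.2.2.2.2, h.conj_left hLZ, h.swap_eq_inv, h.conj_left hLZ, ← h.swap_eq_inv]

end IsMulLie

theorem mul_mul_mul_of_mem_center {G : Type*} [Group G] {p q r : G} (b c d : G)
    (hq : q ∈ Subgroup.center G) (hr : r ∈ Subgroup.center G) :
    p * b * (q * c) * (r * d) = p * q * r * (b * c * d) := by
  have hq' := Subgroup.mem_center_iff.mp hq
  have hr' := Subgroup.mem_center_iff.mp hr
  calc p * b * (q * c) * (r * d) = p * (b * q) * (c * r) * d := by group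
    _ = p * q * (b * r) * c * d := by rw [hq', hr']; group
    _ = p * q * r * (b * c * d) := by rw [hr']; group

/-- Let `G` be nilpotent of class 2, `⋆₁` a multiplicative Lie algebra structure
with `[G,G] ⊆ LZ(G)` w.r.t. `⋆₁`, and `⋆₂` any other multiplicative Lie algebra
structure. If the mixed Jacobi identity holds, then `x ⋆ y := (x ⋆₁ y)(x ⋆₂ y)` is
a multiplicative Lie algebra structure on `G`. -/
theorem stmt_16 {G : Type*} [Group G] (s1 s2 : G → G → G)
    (hnil : commutator G ≤ Subgroup.center G)
    (hs1 : IsMulLie s1) (hs2 : IsMulLie s2)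
    (hLZ : ∀ c g : G, c ∈ commutator G → s1 c g = 1)
    (hjac : ∀ x y z : G,
      s2 (s1 x y) (y * z * y⁻¹) * s1 (s2 x y) (y * z * y⁻¹) *
      s2 (s1 y z) (z * x * z⁻¹) * s1 (s2 y z) (z * x * z⁻¹) *
      s2 (s1 z x) (x * y * x⁻¹) * s1 (s2 z x) (x * y * x⁻¹) = 1) :
    IsMulLie (fun x y => s1 x y * s2 x y) := by
  have c1 := hs1.mem_center hLZ
  have c1' : ∀ x y g, g * s1 x y = s1 x y * g := fun x y =>
    Subgroup.mem_center_iff.mp (c1 x y)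
  have cj : ∀ x y g, g * s1 x y * g⁻¹ = s1 x y := fun x y g => by
    rw [c1', mul_inv_cancel_right]
  have key : ∀ x y w, s1 (s1 x y * s2 x y) w * s2 (s1 x y * s2 x y) w =
      s1 (s1 x y) w * (s2 (s1 x y) w * s1 (s2 x y) w) * s2 (s2 x y) w := fun x y w => by
    have e : s1 x y * s2 (s2 x y) w * (s1 x y)⁻¹ = s2 (s2 x y) w := by
      rw [← c1', mul_inv_cancel_right]
    have hN := Subgroup.mem_center_iff.mp (hs2.mem_center_of_left (c1 x y) w)
    rw [hs1.2.2.1, hs2.2.2.1, cj, e, hN, c1' (s1 x y)]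
    have hM := c1' (s2 x y) w (s2 (s1 x y) w)
    calc _ = s1 (s1 x y) w * (s1 (s2 x y) w * s2 (s1 x y) w) * s2 (s2 x y) w := by group
      _ = _ := by rw [← hM]
  refine ⟨fun x => ?_, fun x y z => ?_, fun x y z => ?_, fun x y z => ?_, fun x y z => ?_⟩
  · simp only [hs1.1, hs2.1, mul_one]
  · simp only [hs1.2.1, hs2.2.1, cj]
    calc _ = s1 x y * (s1 x z * s2 x y) * (y * s2 x z * y⁻¹) := by group
      _ = s1 x y * s2 x y * (s1 x z * y) * s2 x z * y⁻¹ := by rw [← c1' x z]; group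
      _ = _ := by rw [← c1' x z]; group
  · simp only [hs1.2.2.1, hs2.2.2.1, cj]
    calc _ = s1 y z * (s1 x z * (x * s2 y z * x⁻¹)) * s2 x z := by group
      _ = (s1 y z * x) * s2 y z * x⁻¹ * s1 x z * s2 x z := by rw [← c1' x z]; group
      _ = _ := by rw [← c1' y z]; group
  · have hP : ∀ x y w, s2 (s1 x y) w * s1 (s2 x y) w ∈ Subgroup.center G := fun x y w =>
      mul_mem (hs2.mem_center_of_left (c1 x y) w) (c1 _ _)
    simp only [key]
    rw [mul_mul_mul_of_mem_center _ _ _ (mul_mem (c1 _ _) (hP _ _ _))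
      (mul_mem (c1 _ _) (hP _ _ _)), hs2.2.2.2.1, mul_one,
      mul_mul_mul_of_mem_center _ _ _ (c1 _ _) (c1 _ _), hs1.2.2.2.1, one_mul, ← hjac x y z]
    simp only [mul_assoc]
  · simp only [← hs1.2.2.2.2, ← hs2.2.2.2.2]
    group
end

section
/- Let (G, ·, ⋆) be a multiplicative Lie algebra whose underlying group is nilpotent of class 2, and suppose a ⋆ b ∈ [G,G] for all a, b ∈ G (i.e. the induced multiplicative Lie algebra structure on G/[G,G] is trivial). Then the map (a,b) ↦ a ⋆ b is determined by a map h : G/[G,G] × G/[G,G] → [G,G]; that is: (i) a ⋆ b depends only on the cosets a[G,G] and b[G,G] (if a' ∈ a[G,G] and b' ∈ b[G,G] then a' ⋆ b' = a ⋆ b); (ii) a ⋆ a = 1; (iii) (ab) ⋆ c = (a ⋆ c)·(b ⋆ c); and (iv) a ⋆ (bc) = (a ⋆ b)·(a ⋆ c), for all a, b, c ∈ G. -/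
/-- A multiplicative map whose values are central is trivial on the commutator subgroup. -/
theorem map_eq_one_of_mem_commutator {G : Type*} [Group G] (f : G → G)
    (hmul : ∀ a b : G, f (a * b) = f a * f b) (hcen : ∀ a : G, f a ∈ Subgroup.center G)
    {x : G} (hx : x ∈ commutator G) : f x = 1 := by
  let F : G →* Subgroup.center G :=
    MonoidHom.mk' (fun a => ⟨f a, hcen a⟩) fun a b => Subtype.ext (hmul a b)
  have hker : commutator G ≤ F.ker := by
    refine Subgroup.commutator_le.mpr fun a _ b _ => ?_
    rw [MonoidHom.mem_ker, map_commutatorElement, commutatorElement_eq_one_iff_mul_comm]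
    exact Subtype.ext (Subgroup.mem_center_iff.mp (hcen b) (f a))
  exact congrArg Subtype.val (MonoidHom.mem_ker.mp (hker hx))

/-- If the underlying group of a multiplicative Lie algebra is nilpotent of class 2
and `a ⋆ b ∈ [G,G]` for all `a, b` (the induced structure on `G/[G,G]` is trivial),
then `⋆` is determined by a map `h : G/[G,G] × G/[G,G] → [G,G]`: (i) `a ⋆ b`
depends only on the cosets `a[G,G]`, `b[G,G]`; (ii) `a ⋆ a = 1`; (iii) `⋆` is
multiplicative in the left argument; (iv) `⋆` is multiplicative in the right
argument. -/
theorem stmt_19 {G : Type*} [Group G] (s : G → G → G) (hs : IsMulLie s)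
    (hnil : commutator G ≤ Subgroup.center G)
    (htriv : ∀ a b : G, s a b ∈ commutator G) :
    (∀ a b a' b' : G, a⁻¹ * a' ∈ commutator G → b⁻¹ * b' ∈ commutator G →
      s a' b' = s a b) ∧
    (∀ a : G, s a a = 1) ∧
    (∀ a b c : G, s (a * b) c = s a c * s b c) ∧
    (∀ a b c : G, s a (b * c) = s a b * s a c) := by
  obtain ⟨hself, hright, hleft, -, -⟩ := hs
  have hcen : ∀ a b : G, s a b ∈ Subgroup.center G := fun a b => hnil (htriv a b)
  have hcomm : ∀ a b g : G, g * s a b = s a b * g := fun a b g =>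
    Subgroup.mem_center_iff.mp (hcen a b) g
  have hl : ∀ a b c : G, s (a * b) c = s a c * s b c := fun a b c => by
    rw [hleft, hcomm b c a, mul_inv_cancel_right, hcomm a c]
  have hr : ∀ a b c : G, s a (b * c) = s a b * s a c := fun a b c => by
    rw [hright, hcomm a c b, mul_inv_cancel_right]
  refine ⟨fun a b a' b' ha hb => ?_, hself, hl, hr⟩
  have hl1 : s (a⁻¹ * a') b' = 1 :=
    map_eq_one_of_mem_commutator (fun x => s x b') (fun x y => hl x y b') (fun x => hcen x b') ha
  have hr1 : s a (b⁻¹ * b') = 1 :=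
    map_eq_one_of_mem_commutator (s a) (hr a) (hcen a) hb
  calc s a' b' = s (a * (a⁻¹ * a')) b' := by rw [mul_inv_cancel_left]
    _ = s a (b * (b⁻¹ * b')) := by rw [hl, hl1, mul_one, mul_inv_cancel_left]
    _ = s a b := by rw [hr, hr1, mul_one]
end
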